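/- arXiv:2110.03978 — 4 statements merged into one kernel-verified Lean document; each statement's English description precedes it below -/
import Mathlib

section
/- The generalized Petersen graph GP(8,2) has exactly 17 perfect matchings, of which exactly 8 have forcing number 3 and exactly 9 have forcing number 2; equivalently, its forcing polynomial is 8x^3 + 9x^2. -/
open SimpleGraph

/-- The generalized Petersen graph `GP(n,k)`: vertices `u i = Sum.inl i`,
`v i = Sum.inr i`, edges `u i -- u (i+k)`, `u i -- v i`, `v i -- v (i+1)` (mod n). -/
def GP (n k : ℕ) : SimpleGraph (Fin n ⊕ Fin n) :=
  SimpleGraph.fromRel (fun a b =>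
    match a, b with
    | Sum.inl i, Sum.inl j => (j : ℕ) = ((i : ℕ) + k) % n
    | Sum.inl i, Sum.inr j => i = j
    | Sum.inr i, Sum.inr j => (j : ℕ) = ((i : ℕ) + 1) % n
    | _, _ => False)

/-- `S` is a forcing set of the perfect matching `M` of `G`:
`S` consists of edges of `M` and `M` is the unique perfect matching containing `S`. -/
def IsForcingSet {V : Type*} (G : SimpleGraph V) (M : G.Subgraph) (S : Set (Sym2 V)) : Prop :=
  S ⊆ M.edgeSet ∧
    ∀ M' : G.Subgraph, M'.IsPerfectMatching → S ⊆ M'.edgeSet → M' = M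

/-- The forcing number `f(G,M)`: minimum cardinality of a forcing set of `M`. -/
noncomputable def forcingNum {V : Type*} (G : SimpleGraph V) (M : G.Subgraph) : ℕ :=
  sInf {k | ∃ S : Set (Sym2 V), IsForcingSet G M S ∧ S.ncard = k}

/-- A cycle `p` of `G` is `M`-alternating: its edges lie alternately in `M` and outside `M`.
For a perfect matching `M` this is equivalent to saying that every vertex of the
cycle is covered by an edge of `M` lying on the cycle. -/
def IsAltCycle {V : Type*} (G : SimpleGraph V) (M : G.Subgraph) {v : V} (p : G.Walk v v) : Prop :=
  p.IsCycle ∧ ∀ u ∈ p.support, ∃ e ∈ p.edges, e ∈ M.edgeSet ∧ u ∈ e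

/-- `C(G,M)`: the maximum number of pairwise vertex-disjoint `M`-alternating cycles of `G`. -/
noncomputable def maxDisjAltCycles {V : Type*} (G : SimpleGraph V) (M : G.Subgraph) : ℕ :=
  sSup {k | ∃ c : Fin k → Σ v : V, G.Walk v v,
    (∀ i, IsAltCycle G M (c i).2) ∧
    Pairwise fun i j => List.Disjoint (c i).2.support (c j).2.support}

/-! Numerical coding of the vertices: `u i` is `i`, `v i` is `8 + i`. -/
namespace GPaux

abbrev V := Fin 8 ⊕ Fin 8

instance : DecidableRel (GP 8 2).Adj := fun a b => by
  unfold GP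
  rw [SimpleGraph.fromRel_adj]
  rcases a with a | a <;> rcases b with b | b <;> dsimp only <;> infer_instance

def enc : V → ℕ
  | Sum.inl i => i.val
  | Sum.inr i => 8 + i.val

def dec (k : ℕ) : V :=
  if k < 8 then Sum.inl (Fin.ofNat 8 k) else Sum.inr (Fin.ofNat 8 k)

/-- The partner tables of the perfect matchings. -/
def table : List (List ℕ) :=
  [[2, 3, 0, 1, 6, 7, 4, 5, 9, 8, 11, 10, 13, 12, 15, 14],
   [2, 3, 0, 1, 6, 7, 4, 5, 15, 10, 9, 12, 11, 14, 13, 8],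
   [2, 7, 0, 5, 6, 3, 4, 1, 9, 8, 11, 10, 13, 12, 15, 14],
   [2, 7, 0, 5, 6, 3, 4, 1, 15, 10, 9, 12, 11, 14, 13, 8],
   [6, 3, 4, 1, 2, 7, 0, 5, 9, 8, 11, 10, 13, 12, 15, 14],
   [6, 3, 4, 1, 2, 7, 0, 5, 15, 10, 9, 12, 11, 14, 13, 8],
   [6, 7, 4, 5, 2, 3, 0, 1, 9, 8, 11, 10, 13, 12, 15, 14],
   [6, 7, 4, 5, 2, 3, 0, 1, 15, 10, 9, 12, 11, 14, 13, 8],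
   [2, 3, 0, 1, 12, 13, 14, 15, 9, 8, 11, 10, 4, 5, 6, 7],
   [2, 7, 0, 11, 12, 13, 14, 1, 15, 10, 9, 3, 4, 5, 6, 8],
   [6, 7, 10, 11, 12, 13, 0, 1, 9, 8, 2, 3, 4, 5, 15, 14],
   [6, 9, 10, 11, 12, 7, 0, 5, 15, 1, 2, 3, 4, 14, 13, 8],
   [8, 3, 4, 1, 2, 13, 14, 15, 0, 10, 9, 12, 11, 5, 6, 7],
   [8, 9, 4, 5, 2, 3, 14, 15, 0, 1, 11, 10, 13, 12, 6, 7],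
   [8, 9, 10, 5, 6, 3, 4, 15, 0, 1, 2, 12, 11, 14, 13, 7],
   [8, 9, 10, 11, 6, 7, 4, 5, 0, 1, 2, 3, 13, 12, 15, 14],
   [8, 9, 10, 11, 12, 13, 14, 15, 0, 1, 2, 3, 4, 5, 6, 7]]

/-- Partner of the vertex `a` in the `i`-th perfect matching. -/
def p (i : Fin 17) (a : V) : V := dec ((table.getD i.val []).getD (enc a) 0)

theorem p_adj : ∀ i a, (GP 8 2).Adj a (p i a) := by decide +kernel

theorem p_invol : ∀ i a, p i (p i a) = a := by decide +kernel

theorem p_inj : ∀ i j, (∀ a, p i a = p j a) → i = j := by decide +kernel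

theorem upper3 : ∀ i : Fin 17, ∃ a b c : V, ∀ j,
    p j a = p i a → p j b = p i b → p j c = p i c → j = i := by decide +kernel

theorem upper2 : ∀ i : Fin 17, 8 ≤ i.val → ∃ a b : V, ∀ j,
    p j a = p i a → p j b = p i b → j = i := by decide +kernel

theorem lower3 : ∀ i : Fin 17, i.val < 8 → ∀ a b : V, ∃ j, j ≠ i ∧
    p j a = p i a ∧ p j b = p i b := by decide +kernel

theorem lower2 : ∀ i : Fin 17, ∀ a : V, ∃ j, j ≠ i ∧ p j a = p i a := by decide +kernel

def allV : List V := (List.range 16).map dec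

theorem contains_allV : ∀ a : V, (allV.any fun x => decide (x = a)) = true := by decide +kernel

theorem mem_allV (a : V) : a ∈ allV := by
  obtain ⟨x, hx, h⟩ := List.any_eq_true.1 (contains_allV a)
  exact of_decide_eq_true h ▸ hx

/-- Backtracking search through all partner functions. -/
def search : List V → List (V × V) → Bool
  | [], asg => (List.finRange 17).any fun i => asg.all fun x => decide (p i x.1 = x.2)
  | v :: vs, asg => (allV.filter fun w => decide ((GP 8 2).Adj v w)).all fun w =>
      !(asg.all fun x => decide (x.1 = w ↔ x.2 = v)) || search vs ((v, w) :: asg)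

theorem search_sound (f : V → V) (h1 : ∀ v, (GP 8 2).Adj v (f v)) (h2 : ∀ v, f (f v) = v) :
    ∀ vs asg, search vs asg = true → (∀ x ∈ asg, f x.1 = x.2) →
      ∃ i, (∀ x ∈ asg, p i x.1 = f x.1) ∧ ∀ v ∈ vs, p i v = f v := by
  intro vs
  induction vs with
  | nil =>
    intro asg hs ha
    simp only [search, List.any_eq_true, List.all_eq_true, decide_eq_true_eq] at hs
    obtain ⟨i, -, hi⟩ := hs
    exact ⟨i, fun x hx => by rw [hi x hx, ha x hx], by simp⟩
  | cons v vs ih =>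
    intro asg hs ha
    simp only [search, List.all_eq_true] at hs
    have hs' := hs (f v) (by simp [mem_allV, h1])
    have hc : (asg.all fun x => decide (x.1 = f v ↔ x.2 = v)) = true := by
      simp only [List.all_eq_true, decide_eq_true_eq]
      intro x hx
      rw [← ha x hx]
      constructor
      · intro h; rw [h, h2]
      · intro h; rw [← h, h2]
    rw [hc] at hs'
    obtain ⟨i, hi1, hi2⟩ := ih _ (by simpa using hs') (by
      intro x hx
      rcases List.mem_cons.1 hx with rfl | hx
      · rfl
      · exact ha x hx)
    refine ⟨i, fun x hx => hi1 x (List.mem_cons_of_mem _ hx), fun w hw => ?_⟩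
    rcases List.mem_cons.1 hw with rfl | hw
    · exact hi1 (w, f w) List.mem_cons_self
    · exact hi2 w hw

/-- The search finds nothing outside the table. -/
theorem search_true : search allV [] = true := by decide +kernel

/-- The `i`-th perfect matching. -/
def PM (i : Fin 17) : (GP 8 2).Subgraph where
  verts := Set.univ
  Adj a b := p i a = b
  adj_sub := by rintro a _ rfl; exact p_adj i a
  edge_vert := fun _ => Set.mem_univ _
  symm := ⟨by rintro a _ rfl; exact p_invol i a⟩

theorem PM_adj (i : Fin 17) (a b : V) : (PM i).Adj a b ↔ p i a = b := Iff.rfl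

theorem PM_perfect (i : Fin 17) : (PM i).IsPerfectMatching := by
  rw [SimpleGraph.Subgraph.isPerfectMatching_iff]
  intro v
  exact ⟨p i v, rfl, fun y hy => Eq.symm hy⟩

theorem PM_complete (M : (GP 8 2).Subgraph) (hM : M.IsPerfectMatching) : ∃ i, PM i = M := by
  have hM' := SimpleGraph.Subgraph.isPerfectMatching_iff.1 hM
  choose f hf hu using hM'
  have h2 : ∀ v, f (f v) = v := fun v => (hu (f v) v (hf v).symm).symm
  obtain ⟨i, -, hi⟩ := search_sound f (fun v => (hf v).adj_sub) h2 allV [] search_true (by simp)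
  refine ⟨i, SimpleGraph.Subgraph.ext ?_ ?_⟩
  · exact (SimpleGraph.Subgraph.isSpanning_iff.1 hM.2).symm
  · funext a b
    apply propext
    rw [PM_adj, hi a (mem_allV a)]
    constructor
    · rintro rfl; exact hf a
    · intro h; exact (hu a b h).symm

theorem PM_inj : Function.Injective PM := by
  intro i j h
  apply p_inj
  intro a
  have : (PM j).Adj a (p i a) := by rw [← h]; rfl
  exact Eq.symm this

theorem mem_edge (i : Fin 17) (a b : V) : s(a, b) ∈ (PM i).edgeSet ↔ p i a = b := Iff.rfl

theorem edge_form (i : Fin 17) (e : Sym2 V) (he : e ∈ (PM i).edgeSet) : ∃ a, e = s(a, p i a) := by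
  induction e using Sym2.ind with
  | _ a b => exact ⟨a, by rw [(mem_edge i a b).1 he]⟩

theorem forcing_iff (i : Fin 17) (S : Set (Sym2 V)) : IsForcingSet (GP 8 2) (PM i) S ↔
    S ⊆ (PM i).edgeSet ∧ ∀ j, S ⊆ (PM j).edgeSet → j = i := by
  refine and_congr_right fun _ => ⟨fun h j hj => PM_inj (h _ (PM_perfect j) hj), ?_⟩
  intro h M' hM' hS
  obtain ⟨j, rfl⟩ := PM_complete M' hM'
  rw [h j hS]

theorem not_small (i : Fin 17) (S : Set (Sym2 V)) (hS : IsForcingSet (GP 8 2) (PM i) S) :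
    2 ≤ S.ncard := by
  rw [forcing_iff] at hS
  obtain ⟨h1, h2⟩ := hS
  by_contra hlt
  have : ∃ a, S ⊆ {s(a, p i a)} := by
    have hc : S.ncard ≤ 1 := by omega
    rcases S.eq_empty_or_nonempty with rfl | ⟨e, he⟩
    · exact ⟨Sum.inl 0, Set.empty_subset _⟩
    · obtain ⟨a, rfl⟩ := edge_form i e (h1 he)
      exact ⟨a, fun x hx => (Set.ncard_le_one (Set.toFinite S)).1 hc x hx _ he⟩
  obtain ⟨a, ha⟩ := this
  obtain ⟨j, hj, hja⟩ := lower2 i a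
  refine hj (h2 j fun e he => ?_)
  rw [ha he]
  exact hja

theorem not_small' (i : Fin 17) (hi : i.val < 8) (S : Set (Sym2 V))
    (hS : IsForcingSet (GP 8 2) (PM i) S) : 3 ≤ S.ncard := by
  have h0 := not_small i S hS
  rw [forcing_iff] at hS
  obtain ⟨h1, h2⟩ := hS
  by_contra hlt
  obtain ⟨e, e', -, rfl⟩ := Set.ncard_eq_two.1 (show S.ncard = 2 by omega)
  obtain ⟨a, rfl⟩ := edge_form i e (h1 (by simp))
  obtain ⟨b, rfl⟩ := edge_form i e' (h1 (by simp))
  obtain ⟨j, hj, hja, hjb⟩ := lower3 i hi a b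
  refine hj (h2 j fun e he => ?_)
  rcases he with rfl | rfl
  · exact hja
  · exact hjb

theorem num2 (i : Fin 17) (hi : 8 ≤ i.val) : forcingNum (GP 8 2) (PM i) = 2 := by
  obtain ⟨a, b, h⟩ := upper2 i hi
  have hF : IsForcingSet (GP 8 2) (PM i) {s(a, p i a), s(b, p i b)} := by
    rw [forcing_iff]
    refine ⟨?_, fun j hj => h j (hj (a := s(a, p i a)) (by simp)) (hj (a := s(b, p i b)) (by simp))⟩
    rintro e (rfl | rfl) <;> exact rfl
  apply le_antisymm
  · refine le_trans (b := Set.ncard {s(a, p i a), s(b, p i b)}) (Nat.sInf_le ⟨_, hF, rfl⟩) ?_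
    exact (Set.ncard_insert_le _ _).trans (by simp)
  · refine le_csInf ⟨_, _, hF, rfl⟩ ?_
    rintro k ⟨S, hS, rfl⟩
    exact not_small i S hS

theorem num3 (i : Fin 17) (hi : i.val < 8) : forcingNum (GP 8 2) (PM i) = 3 := by
  obtain ⟨a, b, c, h⟩ := upper3 i
  have hF : IsForcingSet (GP 8 2) (PM i) {s(a, p i a), s(b, p i b), s(c, p i c)} := by
    rw [forcing_iff]
    refine ⟨?_, fun j hj => h j (hj (a := s(a, p i a)) (by simp)) (hj (a := s(b, p i b)) (by simp))
      (hj (a := s(c, p i c)) (by simp))⟩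
    rintro e (rfl | rfl | rfl) <;> exact rfl
  apply le_antisymm
  · refine le_trans (b := Set.ncard {s(a, p i a), s(b, p i b), s(c, p i c)})
      (Nat.sInf_le ⟨_, hF, rfl⟩) ((Set.ncard_insert_le _ _).trans ?_)
    have := Set.ncard_insert_le s(b, p i b) {s(c, p i c)}
    rw [Set.ncard_singleton] at this
    omega
  · refine le_csInf ⟨_, _, hF, rfl⟩ ?_
    rintro k ⟨S, hS, rfl⟩
    exact not_small' i hi S hS

theorem count (P : (GP 8 2).Subgraph → Prop) (Q : Fin 17 → Prop) [DecidablePred Q]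
    (h : ∀ i, P (PM i) ↔ Q i) :
    {M : (GP 8 2).Subgraph | M.IsPerfectMatching ∧ P M}.ncard =
      (Finset.univ.filter Q).card := by
  have : {M : (GP 8 2).Subgraph | M.IsPerfectMatching ∧ P M} =
      PM '' (Finset.univ.filter Q : Finset (Fin 17)) := by
    ext M
    constructor
    · rintro ⟨hM, hP⟩
      obtain ⟨i, rfl⟩ := PM_complete M hM
      exact ⟨i, by simpa using (h i).1 hP, rfl⟩
    · rintro ⟨i, hi, rfl⟩
      exact ⟨PM_perfect i, (h i).2 (by simpa using hi)⟩
  rw [this, Set.ncard_image_of_injective _ PM_inj, Set.ncard_coe_finset]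

end GPaux

theorem stmt13 :
    {M : (GP 8 2).Subgraph | M.IsPerfectMatching}.ncard = 17 ∧
    {M : (GP 8 2).Subgraph | M.IsPerfectMatching ∧ forcingNum (GP 8 2) M = 3}.ncard = 8 ∧
    {M : (GP 8 2).Subgraph | M.IsPerfectMatching ∧ forcingNum (GP 8 2) M = 2}.ncard = 9 := by 
  refine ⟨?_, ?_, ?_⟩
  · have := GPaux.count (fun _ => True) (fun _ => True) (fun _ => Iff.rfl)
    simpa using this
  · rw [GPaux.count (fun M => forcingNum (GP 8 2) M = 3) (fun i => i.val < 8)]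
    · decide
    · intro i
      by_cases hi : i.val < 8
      · simp [GPaux.num3 i hi, hi]
      · simp [GPaux.num2 i (by omega), hi]
  · rw [GPaux.count (fun M => forcingNum (GP 8 2) M = 2) (fun i => 8 ≤ i.val)]
    · decide
    · intro i
      by_cases hi : i.val < 8
      · simp [GPaux.num3 i hi, hi]
      · simp [GPaux.num2 i (by omega), not_lt.1 hi]
end

section
/- Every perfect matching of the generalized Petersen graph GP(10,2) has forcing number exactly 3, and GP(10,2) has exactly 36 perfect matchings; equivalently, its forcing polynomial is 36x^3. -/
open SimpleGraph

namespace GPTen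

abbrev Vt := Fin 10 ⊕ Fin 10

/-- first endpoint of the edge number `e` -/
def E1 (e : Fin 30) : Vt :=
  if e.1 < 10 then Sum.inl (Fin.ofNat 10 e.1)
  else if e.1 < 20 then Sum.inl (Fin.ofNat 10 e.1) else Sum.inr (Fin.ofNat 10 e.1)

/-- second endpoint of the edge number `e` -/
def E2 (e : Fin 30) : Vt :=
  if e.1 < 10 then Sum.inl (Fin.ofNat 10 (e.1 + 2))
  else if e.1 < 20 then Sum.inr (Fin.ofNat 10 e.1) else Sum.inr (Fin.ofNat 10 (e.1 + 1))

/-- indices of the three edges at a vertex -/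
def inc : Vt → List (Fin 30)
  | Sum.inl i => [Fin.ofNat 30 i.1, Fin.ofNat 30 ((i.1 + 8) % 10), Fin.ofNat 30 (10 + i.1)]
  | Sum.inr i => [Fin.ofNat 30 (10 + i.1), Fin.ofNat 30 (20 + i.1),
      Fin.ofNat 30 (20 + (i.1 + 9) % 10)]

def ed (e : Fin 30) : Sym2 Vt := s(E1 e, E2 e)

theorem adj_E (e : Fin 30) : (GP 10 2).Adj (E1 e) (E2 e) := by
  fin_cases e <;> simp [GP, E1, E2] <;> decide

theorem mem_inc : ∀ (v : Vt) (e : Fin 30), e ∈ inc v ↔ (v = E1 e ∨ v = E2 e) := by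
  decide +kernel

theorem mem_ed {v : Vt} {e : Fin 30} : v ∈ ed e ↔ e ∈ inc v := by
  rw [mem_inc, ed, Sym2.mem_iff]

theorem ed_inj' : ∀ e e' : Fin 30,
    (E1 e = E1 e' ∧ E2 e = E2 e') ∨ (E1 e = E2 e' ∧ E2 e = E1 e') → e = e' := by
  decide +kernel

theorem ed_inj : Function.Injective ed := by
  intro e e' h
  apply ed_inj'
  simpa [ed] using h

theorem cov1 : ∀ i j : Fin 10, (j : ℕ) = ((i : ℕ) + 2) % 10 →
    ∃ e, E1 e = Sum.inl i ∧ E2 e = Sum.inl j := by decide +kernel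
theorem cov2 : ∀ i : Fin 10, ∃ e, E1 e = Sum.inl i ∧ E2 e = Sum.inr i := by decide +kernel
theorem cov3 : ∀ i j : Fin 10, (j : ℕ) = ((i : ℕ) + 1) % 10 →
    ∃ e, E1 e = Sum.inr i ∧ E2 e = Sum.inr j := by decide +kernel

theorem cov {v w : Vt} (h : (GP 10 2).Adj v w) : ∃ e, ed e = s(v, w) := by
  have key : (∃ e, E1 e = v ∧ E2 e = w) ∨ (∃ e, E1 e = w ∧ E2 e = v) := by
    rw [GP, SimpleGraph.fromRel_adj] at h
    obtain ⟨-, h⟩ := h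
    rcases v with i | i <;> rcases w with j | j
    · exact h.imp (cov1 i j) (cov1 j i)
    · rcases h with h | h
      · have h' : i = j := h
        subst h'
        exact Or.inl (cov2 i)
      · exact h.elim
    · rcases h with h | h
      · exact h.elim
      · have h' : j = i := h
        subst h'
        exact Or.inr (cov2 j)
    · exact h.imp (cov3 i j) (cov3 j i)
  rcases key with ⟨e, h1, h2⟩ | ⟨e, h1, h2⟩
  · exact ⟨e, by rw [ed, h1, h2]⟩
  · exact ⟨e, by rw [ed, h1, h2, Sym2.eq_swap]⟩

theorem edge_cov {M : (GP 10 2).Subgraph} {s : Sym2 Vt} (h : s ∈ M.edgeSet) :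
    ∃ e, ed e = s := by
  induction s with
  | h v w => exact cov (M.adj_sub h)

/-- exactly one matching edge at each vertex -/
theorem exact_one {M : (GP 10 2).Subgraph} (hM : M.IsPerfectMatching) (v : Vt) :
    ∃ e ∈ inc v, ed e ∈ M.edgeSet ∧ ∀ e' ∈ inc v, ed e' ∈ M.edgeSet → e' = e := by
  obtain ⟨w, hw, hu⟩ := (SimpleGraph.Subgraph.isPerfectMatching_iff.1 hM) v
  obtain ⟨e, he⟩ := cov (M.adj_sub hw)
  refine ⟨e, mem_ed.1 (by rw [he]; simp), by rw [he]; exact hw, ?_⟩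
  intro e' h1 h2
  obtain ⟨w', hw'⟩ := mem_ed.2 h1
  rw [hw'] at h2
  have := hu w' h2
  subst this
  exact ed_inj (hw'.trans he.symm)

/-- bit mask of a list of edges -/
def maskOf (l : List (Fin 30)) : ℕ := l.foldr (fun e m => m ||| (1 <<< e.1)) 0

theorem testBit_maskOf (l : List (Fin 30)) (e : Fin 30) :
    (maskOf l).testBit e.1 = true ↔ e ∈ l := by
  induction l with
  | nil => simp [maskOf]
  | cons a l ih =>
    have : maskOf (a :: l) = maskOf l ||| (1 <<< a.1) := rfl
    rw [this, Nat.testBit_or, Bool.or_eq_true, ih, Nat.one_shiftLeft, Nat.testBit_two_pow]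
    simp only [List.mem_cons, decide_eq_true_eq, Fin.ext_iff]
    tauto

/-- branch on the edge covering `v` -/
def step (v : Vt) (s : ℕ × ℕ) : List (ℕ × ℕ) :=
  ((inc v).map fun e => (s.1 ||| maskOf [e], s.2 ||| maskOf ((inc v).filter (· ≠ e)))).filter
    fun t => t.1 &&& t.2 == 0

def search : List Vt → List (ℕ × ℕ) → List (ℕ × ℕ)
  | [], l => l
  | v :: vs, l => search vs (l.flatMap (step v))

def allV : List Vt := (List.finRange 10).flatMap fun i => [Sum.inl i, Sum.inr i]

def sols : List (ℕ × ℕ) := search allV [(0, 0)]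

def L : List ℕ := sols.map Prod.fst

def Cons (X : Fin 30 → Prop) (s : ℕ × ℕ) : Prop :=
  s.1 < 2 ^ 30 ∧ s.2 < 2 ^ 30 ∧
  ∀ e : Fin 30, (s.1.testBit e.1 = true → X e) ∧ (s.2.testBit e.1 = true → ¬ X e)

theorem maskOf_lt (l : List (Fin 30)) : maskOf l < 2 ^ 30 := by
  induction l with
  | nil => simp [maskOf]
  | cons a l ih =>
    have : maskOf (a :: l) = maskOf l ||| (1 <<< a.1) := rfl
    rw [this]
    refine Nat.or_lt_two_pow ih ?_
    rw [Nat.one_shiftLeft]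
    exact Nat.pow_lt_pow_right (by norm_num) a.2

theorem step_cons {X : Fin 30 → Prop} {v : Vt} {s : ℕ × ℕ} (hs : Cons X s)
    (hv : ∃ e ∈ inc v, X e ∧ ∀ e' ∈ inc v, X e' → e' = e) :
    ∃ t ∈ step v s, Cons X t := by
  obtain ⟨e, he, hX, hu⟩ := hv
  obtain ⟨h1, h2, h3⟩ := hs
  have hc : Cons X (s.1 ||| maskOf [e], s.2 ||| maskOf ((inc v).filter (· ≠ e))) := by
    refine ⟨Nat.or_lt_two_pow h1 (maskOf_lt _), Nat.or_lt_two_pow h2 (maskOf_lt _), ?_⟩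
    intro e'
    constructor
    · intro h
      rw [Nat.testBit_or, Bool.or_eq_true, testBit_maskOf] at h
      rcases h with h | h
      · exact (h3 e').1 h
      · rw [List.mem_singleton] at h
        exact h ▸ hX
    · intro h hx
      rw [Nat.testBit_or, Bool.or_eq_true, testBit_maskOf] at h
      rcases h with h | h
      · exact (h3 e').2 h hx
      · rw [List.mem_filter] at h
        have := hu e' h.1 hx
        simp [this] at h
  refine ⟨_, ?_, hc⟩
  rw [step, List.mem_filter]
  refine ⟨List.mem_map.2 ⟨e, he, rfl⟩, ?_⟩
  rw [beq_iff_eq]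
  apply Nat.eq_of_testBit_eq
  intro i
  rw [Nat.zero_testBit, Nat.testBit_and]
  by_cases hi : i < 30
  · by_contra hcon
    rw [Bool.not_eq_false, Bool.and_eq_true] at hcon
    have := hc.2.2 ⟨i, hi⟩
    exact this.2 hcon.2 (this.1 hcon.1)
  · have : (s.1 ||| maskOf [e]).testBit i = false :=
      Nat.testBit_lt_two_pow (lt_of_lt_of_le hc.1 (Nat.pow_le_pow_right (by norm_num) (by omega)))
    rw [this, Bool.false_and]

theorem search_cons {X : Fin 30 → Prop}
    (hX : ∀ v, ∃ e ∈ inc v, X e ∧ ∀ e' ∈ inc v, X e' → e' = e) (vs : List Vt) :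
    ∀ l : List (ℕ × ℕ), (∃ s ∈ l, Cons X s) → ∃ s ∈ search vs l, Cons X s := by
  induction vs with
  | nil => exact fun l h => h
  | cons v vs ih =>
    rintro l ⟨s, hs, hc⟩
    obtain ⟨t, ht, hct⟩ := step_cons hc (hX v)
    exact ih _ ⟨t, List.mem_flatMap.2 ⟨s, hs, ht⟩, hct⟩

theorem sols_full : ∀ s ∈ sols, ∀ e : Fin 30, s.1.testBit e.1 = true ∨ s.2.testBit e.1 = true := by
  decide +kernel

theorem L_nodup : L.Nodup := by decide +kernel
theorem L_length : L.length = 36 := by decide +kernel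
theorem L_lt : ∀ m ∈ L, m < 2 ^ 30 := by decide +kernel
theorem L_exact : ∀ m ∈ L, ∀ v : Vt, ∃ e ∈ inc v, m.testBit e.1 = true ∧
    ∀ e' ∈ inc v, m.testBit e'.1 = true → e' = e := by decide +kernel

/-- edges of a mask -/
def bits (m : ℕ) : List (Fin 30) := (List.finRange 30).filter fun e => m.testBit e.1

theorem mem_bits {m : ℕ} {e : Fin 30} : e ∈ bits m ↔ m.testBit e.1 = true := by
  simp [bits]

theorem L_lower : ∀ m ∈ L, ∀ a ∈ bits m, ∀ b ∈ bits m, ∃ m' ∈ L, m' ≠ m ∧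
    m'.testBit a.1 = true ∧ m'.testBit b.1 = true := by decide +kernel
theorem L_upper : ∀ m ∈ L, ∃ a ∈ bits m, ∃ b ∈ bits m, ∃ c ∈ bits m, a ≠ b ∧ a ≠ c ∧ b ≠ c ∧
    ∀ m' ∈ L, m'.testBit a.1 = true → m'.testBit b.1 = true → m'.testBit c.1 = true → m' = m := by
  decide +kernel
theorem L_bits_ne : ∀ m ∈ L, ∃ a, a ∈ bits m := by decide +kernel

/-- `m` is the mask of `M` -/
def Rep (M : (GP 10 2).Subgraph) (m : ℕ) : Prop :=
  ∀ e : Fin 30, m.testBit e.1 = true ↔ ed e ∈ M.edgeSet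

theorem exists_rep {M : (GP 10 2).Subgraph} (hM : M.IsPerfectMatching) :
    ∃ m ∈ L, Rep M m := by
  obtain ⟨s, hs, -, -, hc⟩ := search_cons (X := fun e => ed e ∈ M.edgeSet) (exact_one hM) allV
    [(0, 0)] ⟨(0, 0), by simp, by simp [Cons]⟩
  refine ⟨s.1, List.mem_map.2 ⟨s, hs, rfl⟩, fun e => ⟨(hc e).1, fun h => ?_⟩⟩
  rcases sols_full s hs e with h' | h'
  · exact h'
  · exact absurd h ((hc e).2 h')

/-- the subgraph of a mask -/
def toSub (m : ℕ) : (GP 10 2).Subgraph where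
  verts := Set.univ
  Adj v w := ∃ e : Fin 30, m.testBit e.1 = true ∧ ed e = s(v, w)
  adj_sub := by
    rintro v w ⟨e, -, h⟩
    have := adj_E e
    rw [← SimpleGraph.mem_edgeSet] at this ⊢
    rw [← h]
    exact this
  edge_vert := fun _ => Set.mem_univ _
  symm := ⟨by
    rintro v w ⟨e, h, h'⟩
    exact ⟨e, h, h'.trans Sym2.eq_swap⟩⟩

theorem rep_toSub (m : ℕ) : Rep (toSub m) m := by
  intro e
  change _ ↔ ∃ e' : Fin 30, m.testBit e'.1 = true ∧ ed e' = ed e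
  constructor
  · exact fun h => ⟨e, h, rfl⟩
  · rintro ⟨e', h, h'⟩
    exact ed_inj h' ▸ h

theorem toSub_pm {m : ℕ} (hm : m ∈ L) : (toSub m).IsPerfectMatching := by
  rw [SimpleGraph.Subgraph.isPerfectMatching_iff]
  intro v
  obtain ⟨e, he, hb, hu⟩ := L_exact m hm v
  obtain ⟨w, hw⟩ := mem_ed.2 he
  refine ⟨w, ⟨e, hb, hw⟩, ?_⟩
  rintro w' ⟨e', hb', hw'⟩
  have h1 := hu e' (mem_ed.1 (by rw [hw']; simp)) hb'
  subst h1
  exact Sym2.congr_right.1 (hw'.symm.trans hw)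

theorem rep_unique {M M' : (GP 10 2).Subgraph} (hM : M.IsPerfectMatching)
    (hM' : M'.IsPerfectMatching) {m : ℕ} (h : Rep M m) (h' : Rep M' m) : M = M' := by
  apply SimpleGraph.Subgraph.ext
  · rw [hM.2.verts_eq_univ, hM'.2.verts_eq_univ]
  · funext v w
    apply propext
    constructor
    · intro hv
      obtain ⟨e, he⟩ := cov (M.adj_sub hv)
      have h1 := (h e).2 (by rw [he]; exact hv)
      have h2 := (h' e).1 h1
      rw [he] at h2
      exact h2
    · intro hv
      obtain ⟨e, he⟩ := cov (M'.adj_sub hv)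
      have h1 := (h' e).2 (by rw [he]; exact hv)
      have h2 := (h e).1 h1
      rw [he] at h2
      exact h2

theorem mask_unique {M : (GP 10 2).Subgraph} {m m' : ℕ} (hm : m ∈ L) (hm' : m' ∈ L)
    (h : Rep M m) (h' : Rep M m') : m = m' := by
  apply Nat.eq_of_testBit_eq
  intro i
  by_cases hi : i < 30
  · exact Bool.eq_iff_iff.2 ((h ⟨i, hi⟩).trans (h' ⟨i, hi⟩).symm)
  · have hp : 2 ^ 30 ≤ 2 ^ i := Nat.pow_le_pow_right (by norm_num) (by omega)
    rw [Nat.testBit_lt_two_pow ((L_lt m hm).trans_le hp),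
      Nat.testBit_lt_two_pow ((L_lt m' hm').trans_le hp)]

theorem count : {M : (GP 10 2).Subgraph | M.IsPerfectMatching}.ncard = 36 := by
  have h1 : {M : (GP 10 2).Subgraph | M.IsPerfectMatching} =
      toSub '' ((L.toFinset : Finset ℕ) : Set ℕ) := by
    ext M
    constructor
    · intro hM
      obtain ⟨m, hm, hr⟩ := exists_rep hM
      exact ⟨m, by simpa using hm, rep_unique (toSub_pm hm) hM (rep_toSub m) hr⟩
    · rintro ⟨m, hm, rfl⟩
      exact toSub_pm (by simpa using hm)
  rw [h1, Set.InjOn.ncard_image, Set.ncard_coe_finset, List.toFinset_card_of_nodup L_nodup,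
    L_length]
  intro m hm m' hm' h
  have hm1 : m ∈ L := by simpa using hm
  have hm2 : m' ∈ L := by simpa using hm'
  exact mask_unique hm1 hm2 (rep_toSub m) (by rw [h]; exact rep_toSub m')

theorem small_sub {M : (GP 10 2).Subgraph} {m : ℕ} (hm : m ∈ L) (hr : Rep M m)
    {S : Set (Sym2 Vt)} (hS : S ⊆ M.edgeSet) (hc : S.ncard ≤ 2) :
    ∃ a ∈ bits m, ∃ b ∈ bits m, S ⊆ {ed a, ed b} := by
  have lift : ∀ s ∈ S, ∃ a ∈ bits m, ed a = s := by
    intro s hs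
    obtain ⟨e, rfl⟩ := edge_cov (hS hs)
    exact ⟨e, mem_bits.2 ((hr e).2 (hS hs)), rfl⟩
  have hc' : S.ncard = 0 ∨ S.ncard = 1 ∨ S.ncard = 2 := by omega
  rcases hc' with h | h | h
  · rw [Set.ncard_eq_zero S.toFinite] at h
    obtain ⟨a, ha⟩ := L_bits_ne m hm
    exact ⟨a, ha, a, ha, by simp [h]⟩
  · obtain ⟨s, rfl⟩ := Set.ncard_eq_one.1 h
    obtain ⟨a, ha, rfl⟩ := lift s (by simp)
    exact ⟨a, ha, a, ha, by simp⟩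
  · obtain ⟨s, t, -, rfl⟩ := Set.ncard_eq_two.1 h
    obtain ⟨a, ha, rfl⟩ := lift s (by simp)
    obtain ⟨b, hb, rfl⟩ := lift t (by simp)
    exact ⟨a, ha, b, hb, subset_rfl⟩

theorem forcing {M : (GP 10 2).Subgraph} (hM : M.IsPerfectMatching) :
    forcingNum (GP 10 2) M = 3 := by
  obtain ⟨m, hm, hr⟩ := exists_rep hM
  have hmem : 3 ∈ {k | ∃ S : Set (Sym2 Vt), IsForcingSet (GP 10 2) M S ∧ S.ncard = k} := by
    obtain ⟨a, ha, b, hb, c, hc, hab, hac, hbc, hu⟩ := L_upper m hm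
    refine ⟨{ed a, ed b, ed c}, ⟨?_, ?_⟩, ?_⟩
    · rintro s (rfl | rfl | rfl)
      · exact (hr a).1 (mem_bits.1 ha)
      · exact (hr b).1 (mem_bits.1 hb)
      · exact (hr c).1 (mem_bits.1 hc)
    · intro M' hM' hS
      obtain ⟨m', hm', hr'⟩ := exists_rep hM'
      have := hu m' hm' ((hr' a).2 (hS (by simp))) ((hr' b).2 (hS (by simp)))
        ((hr' c).2 (hS (by simp)))
      subst this
      exact rep_unique hM' hM hr' hr
    · exact Set.ncard_eq_three.2 ⟨_, _, _, ed_inj.ne hab, ed_inj.ne hac, ed_inj.ne hbc, rfl⟩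
  apply le_antisymm
  · exact Nat.sInf_le hmem
  · refine le_csInf ⟨3, hmem⟩ ?_
    rintro k ⟨S, ⟨hS, hu⟩, rfl⟩
    by_contra hlt
    obtain ⟨a, ha, b, hb, hab⟩ := small_sub hm hr hS (by omega)
    obtain ⟨m', hm', hne, h1, h2⟩ := L_lower m hm a ha b hb
    apply hne
    have hsub : S ⊆ (toSub m').edgeSet := by
      intro s hs
      rcases hab hs with rfl | rfl
      · exact (rep_toSub m' a).1 h1
      · exact (rep_toSub m' b).1 h2
    have := hu (toSub m') (toSub_pm hm') hsub
    exact mask_unique hm' hm (this ▸ rep_toSub m') hr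

end GPTen

theorem stmt15 :
    (∀ M : (GP 10 2).Subgraph, M.IsPerfectMatching → forcingNum (GP 10 2) M = 3) ∧
    {M : (GP 10 2).Subgraph | M.IsPerfectMatching}.ncard = 36 :=
  ⟨fun _ hM => GPTen.forcing hM, GPTen.count⟩
end

section
/- The forcing spectrum of the generalized Petersen graph GP(11,2) is {2,3}: exactly 11 of its 45 perfect matchings have forcing number 2 and 34 have forcing number 3. -/
open SimpleGraph

namespace PF

abbrev V := Fin 11 ⊕ Fin 11

/-- First endpoint of edge number `e`. -/
def ea (e : ℕ) : V :=
  if e < 22 then Sum.inl (Fin.ofNat 11 e) else Sum.inr (Fin.ofNat 11 e)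

/-- Second endpoint of edge number `e`. -/
def eb (e : ℕ) : V :=
  if e < 11 then Sum.inl (Fin.ofNat 11 (e + 2))
  else if e < 22 then Sum.inr (Fin.ofNat 11 e) else Sum.inr (Fin.ofNat 11 (e + 1))

def edgeOf (e : ℕ) : Sym2 V := s(ea e, eb e)

/-- The three edges at a vertex. -/
def inc : V → List ℕ
  | Sum.inl i => [i.val, (i.val + 9) % 11, 11 + i.val]
  | Sum.inr i => [11 + i.val, 22 + i.val, 22 + (i.val + 10) % 11]

theorem inc_lt : ∀ v, ∀ e ∈ inc v, e < 33 ∧ v ∈ edgeOf e := by decide +kernel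

theorem inc_mem : ∀ e < 33, e ∈ inc (ea e) ∧ e ∈ inc (eb e) := by decide +kernel

theorem edge_inj : ∀ e < 33, ∀ f < 33, edgeOf e = edgeOf f → e = f := by decide +kernel

def adjB (a b : V) : Bool :=
  match a, b with
  | Sum.inl i, Sum.inl j => (j : ℕ) = ((i : ℕ) + 2) % 11
  | Sum.inl i, Sum.inr j => i = j
  | Sum.inr i, Sum.inr j => (j : ℕ) = ((i : ℕ) + 1) % 11
  | _, _ => false

theorem adj_iff (a b : V) : (GP 11 2).Adj a b ↔ a ≠ b ∧ (adjB a b ∨ adjB b a) := by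
  unfold GP
  rw [SimpleGraph.fromRel_adj]
  rcases a with a | a <;> rcases b with b | b <;> simp [adjB]

theorem adj_edge (a b : V) (h : (GP 11 2).Adj a b) : ∃ e ∈ inc a, edgeOf e = s(a, b) := by
  rw [adj_iff] at h
  have key : ∀ a b : V, (a ≠ b ∧ (adjB a b ∨ adjB b a)) → ∃ e ∈ inc a, edgeOf e = s(a, b) := by
    decide +kernel
  exact key a b h

theorem edge_adj (e : ℕ) (he : e < 33) : (GP 11 2).Adj (ea e) (eb e) := by
  rw [adj_iff]
  have key : ∀ e < 33, ea e ≠ eb e ∧ (adjB (ea e) (eb e) ∨ adjB (eb e) (ea e)) := by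
    decide +kernel
  exact key e he

theorem mem_inc {e : ℕ} {v : V} (he : e < 33) (hv : v ∈ edgeOf e) : e ∈ inc v := by
  rcases Sym2.mem_iff.1 hv with rfl | rfl
  · exact (inc_mem e he).1
  · exact (inc_mem e he).2

/-- One search step: make sure `v` gets covered. -/
def step (v : V) (m : ℕ) : List ℕ :=
  if (inc v).any (fun e => m.testBit e) then [m]
  else ((inc v).filter fun e =>
    (inc (ea e) ++ inc (eb e)).all fun f => f == e || !m.testBit f).map fun e => m ||| 2 ^ e

def search : List V → List ℕ → List ℕ
  | [], l => l
  | v :: vs, l => search vs (l.flatMap (step v))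

def order : List V := (List.finRange 11).flatMap fun i => [Sum.inl i, Sum.inr i]

/-- Matchings with forcing number 2. -/
def L2 : List ℕ :=
  [2504524953, 2839577801, 5009047859, 5679153555, 5721035161, 1432355430, 2772566822,
  2856330034, 5545133644, 5712660068, 2860518604]

/-- Matchings with forcing number 3. -/
def L3 : List ℕ :=
  [360185907, 695238755, 1365344451, 2705555843, 25133059, 4472964121, 4640490545,
  4975543393, 5645649089, 4305437697, 2236483084, 2320246296, 2487772720, 2822825568,
  2152719872, 5411111686, 5452993292, 5536756504, 5704282928, 5369230080, 716179558,
  1386285254, 2726496646, 46073862, 1428166860, 2768378252, 87955468, 2852141464,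
  171718680, 339245104, 674297952, 1344403648, 2684615040, 4192256]

def L : List ℕ := L2 ++ L3

theorem search_sub : ∀ m ∈ search order [0], m ∈ L := by decide +kernel

theorem L_cover : ∀ m ∈ L, ∀ v, ∃ e ∈ inc v, m.testBit e = true := by decide +kernel

theorem L_uniq : ∀ m ∈ L, ∀ v, ∀ e ∈ inc v, m.testBit e = true →
    ∀ f ∈ inc v, m.testBit f = true → e = f := by decide +kernel

theorem L_lt : ∀ m ∈ L, m < 2 ^ 33 := by decide +kernel

def bits (m : ℕ) : List ℕ := (List.range 33).filter fun e => m.testBit e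

theorem mem_bits {m e : ℕ} : e ∈ bits m ↔ e < 33 ∧ m.testBit e = true := by
  simp [bits]

theorem low2 : ∀ m ∈ L, ∀ e ∈ bits m, ∃ n ∈ L, n ≠ m ∧ n.testBit e = true := by
  decide +kernel

theorem low3 : ∀ m ∈ L3, ∀ e ∈ bits m, ∀ f ∈ bits m,
    ∃ n ∈ L, n ≠ m ∧ n.testBit e = true ∧ n.testBit f = true := by
  decide +kernel

theorem up2 : ∀ m ∈ L2, ∃ e ∈ bits m, ∃ f ∈ bits m, e ≠ f ∧
    ∀ n ∈ L, n.testBit e = true → n.testBit f = true → n = m := by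
  decide +kernel

theorem up3 : ∀ m ∈ L3, ∃ e ∈ bits m, ∃ f ∈ bits m, e ≠ f ∧ ∃ g ∈ bits m, e ≠ g ∧ f ≠ g ∧
    ∀ n ∈ L, n.testBit e = true → n.testBit f = true → n.testBit g = true → n = m := by
  decide +kernel

/-- The spanning subgraph with edge mask `m`. -/
def toM (m : ℕ) : (GP 11 2).Subgraph where
  verts := Set.univ
  Adj a b := ∃ e < 33, m.testBit e = true ∧ edgeOf e = s(a, b)
  adj_sub := by
    rintro a b ⟨e, he, -, h⟩
    have := edge_adj e he
    rw [← SimpleGraph.mem_edgeSet] at this ⊢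
    rw [← h]; exact this
  edge_vert := fun _ => Set.mem_univ _
  symm := ⟨by
    rintro a b ⟨e, he, h1, h2⟩
    exact ⟨e, he, h1, h2.trans Sym2.eq_swap⟩⟩

theorem mem_toM {m : ℕ} {s : Sym2 V} :
    s ∈ (toM m).edgeSet ↔ ∃ e < 33, m.testBit e = true ∧ edgeOf e = s := by
  induction s with | _ a b => exact Iff.rfl

theorem edge_mem_toM {m e : ℕ} (he : e < 33) :
    edgeOf e ∈ (toM m).edgeSet ↔ m.testBit e = true := by
  rw [mem_toM]
  constructor
  · rintro ⟨f, hf, h1, h2⟩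
    rwa [← edge_inj f hf e he h2]
  · intro h
    exact ⟨e, he, h, rfl⟩

theorem toM_pm {m : ℕ} (hm : m ∈ L) : (toM m).IsPerfectMatching := by
  rw [SimpleGraph.Subgraph.isPerfectMatching_iff]
  intro v
  obtain ⟨e, he, hb⟩ := L_cover m hm v
  obtain ⟨hlt, hv⟩ := inc_lt v e he
  obtain ⟨w, hw⟩ := hv
  refine ⟨w, ⟨e, hlt, hb, hw⟩, ?_⟩
  rintro w' ⟨f, hf, hb', hw2⟩
  have hfv : f ∈ inc v := mem_inc hf (by rw [hw2]; exact Sym2.mem_mk_left _ _)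
  have := L_uniq m hm v e he hb f hfv hb'
  subst this
  rw [hw] at hw2
  exact (Sym2.congr_right.1 hw2).symm

theorem toM_inj : Set.InjOn toM {m | m ∈ L} := by
  intro m hm n hn h
  apply Nat.eq_of_testBit_eq
  intro i
  by_cases hi : i < 33
  · rw [Bool.eq_iff_iff, ← edge_mem_toM hi, ← edge_mem_toM hi, h]
  · have h33 : (2 : ℕ) ^ 33 ≤ 2 ^ i := Nat.pow_le_pow_right (by norm_num) (by omega)
    rw [Nat.testBit_lt_two_pow (lt_of_lt_of_le (L_lt m hm) h33),
      Nat.testBit_lt_two_pow (lt_of_lt_of_le (L_lt n hn) h33)]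

section complete
variable {M : (GP 11 2).Subgraph}

theorem cov (hM : M.IsPerfectMatching) (v : V) : ∃ e ∈ inc v, edgeOf e ∈ M.edgeSet := by
  obtain ⟨w, hw, -⟩ := SimpleGraph.Subgraph.isPerfectMatching_iff.1 hM v
  obtain ⟨e, he, h⟩ := adj_edge v w (M.adj_sub hw)
  exact ⟨e, he, by rw [h]; exact hw⟩

theorem uniq (hM : M.IsPerfectMatching) (v : V) {e f : ℕ} (he : e ∈ inc v) (hf : f ∈ inc v)
    (h1 : edgeOf e ∈ M.edgeSet) (h2 : edgeOf f ∈ M.edgeSet) : e = f := by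
  obtain ⟨hlt, w, hw⟩ := inc_lt v e he
  obtain ⟨hlt', w', hw2⟩ := inc_lt v f hf
  rw [hw] at h1
  rw [hw2] at h2
  have := (SimpleGraph.Subgraph.isPerfectMatching_iff.1 hM v).unique h1 h2
  subst this
  exact edge_inj e hlt f hlt' (hw.trans hw2.symm)

/-- `m` is a partial mask of `M`. -/
def Part (M : (GP 11 2).Subgraph) (m : ℕ) : Prop :=
  ∀ e, m.testBit e = true → e < 33 ∧ edgeOf e ∈ M.edgeSet

theorem step_part (hM : M.IsPerfectMatching) (v : V) {m : ℕ} (hm : Part M m) :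
    ∃ n ∈ step v m, Part M n := by
  unfold step
  split_ifs with h
  · exact ⟨m, by simp, hm⟩
  · obtain ⟨e, he, hx⟩ := cov hM v
    have hlt := (inc_lt v e he).1
    refine ⟨m ||| 2 ^ e, ?_, ?_⟩
    · refine List.mem_map.2 ⟨e, List.mem_filter.2 ⟨he, ?_⟩, rfl⟩
      rw [List.all_eq_true]
      intro f hf
      by_cases hb : m.testBit f = true
      · have hfx := (hm f hb).2
        have : f = e := by
          rcases List.mem_append.1 hf with hf | hf
          · exact uniq hM _ hf (inc_mem e hlt).1 hfx hx
          · exact uniq hM _ hf (inc_mem e hlt).2 hfx hx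
        simp [this]
      · simp [hb]
    · intro f hf
      rw [Nat.testBit_or, Bool.or_eq_true, Nat.testBit_two_pow] at hf
      rcases hf with hf | hf
      · exact hm f hf
      · have : e = f := by simpa using hf
        subst this
        exact ⟨hlt, hx⟩

theorem search_part (hM : M.IsPerfectMatching) (vs : List V) :
    ∀ l : List ℕ, (∃ m ∈ l, Part M m) → ∃ n ∈ search vs l, Part M n := by
  induction vs with
  | nil => intro l h; exact h
  | cons v vs ih =>
    rintro l ⟨m, hml, hm⟩
    obtain ⟨n, hn, hp⟩ := step_part hM v hm
    exact ih _ ⟨n, List.mem_flatMap.2 ⟨m, hml, hn⟩, hp⟩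

theorem exists_mask (hM : M.IsPerfectMatching) : ∃ m ∈ L, toM m = M := by
  obtain ⟨m, hm, hp⟩ := search_part hM order [0] ⟨0, by simp, by intro e he; simp at he⟩
  have hL := search_sub m hm
  refine ⟨m, hL, ?_⟩
  ext a b
  · exact ⟨fun _ => hM.2 a, fun _ => Set.mem_univ _⟩
  · constructor
    · rintro ⟨e, he, hb, h⟩
      have := (hp e hb).2
      rw [h] at this
      exact this
    · intro h
      obtain ⟨e, he, hh⟩ := adj_edge a b (M.adj_sub h)
      obtain ⟨f, hf, hb⟩ := L_cover m hL a
      have hx : edgeOf e ∈ M.edgeSet := by rw [hh]; exact h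
      have := uniq hM a he hf hx (hp f hb).2
      subst this
      exact ⟨e, (inc_lt a e he).1, hb, hh⟩

end complete

theorem forcing_of {m : ℕ} {S : Set (Sym2 V)} (hS : S ⊆ (toM m).edgeSet)
    (h : ∀ n ∈ L, S ⊆ (toM n).edgeSet → n = m) : IsForcingSet (GP 11 2) (toM m) S := by
  refine ⟨hS, fun M' hM' hs => ?_⟩
  obtain ⟨n, hn, rfl⟩ := exists_mask hM'
  rw [h n hn hs]

theorem not_forcing {m n : ℕ} (hm : m ∈ L) (hn : n ∈ L) (hne : n ≠ m) {S : Set (Sym2 V)}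
    (hS : S ⊆ (toM n).edgeSet) : ¬ IsForcingSet (GP 11 2) (toM m) S :=
  fun h => hne (toM_inj hn hm (h.2 _ (toM_pm hn) hS))

theorem exists_bit {m : ℕ} (hm : m ∈ L) : ∃ e, e ∈ bits m := by
  obtain ⟨e, he, hb⟩ := L_cover m hm (Sum.inl 0)
  exact ⟨e, mem_bits.2 ⟨(inc_lt _ e he).1, hb⟩⟩

theorem lower_one {m : ℕ} (hm : m ∈ L) {S : Set (Sym2 V)}
    (h : IsForcingSet (GP 11 2) (toM m) S) : 2 ≤ S.ncard := by
  by_contra hlt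
  have : S.ncard = 0 ∨ S.ncard = 1 := by omega
  rcases this with h0 | h1
  · rw [Set.ncard_eq_zero (Set.toFinite S)] at h0
    subst h0
    obtain ⟨e, he⟩ := exists_bit hm
    obtain ⟨n, hn, hne, -⟩ := low2 m hm e he
    exact not_forcing hm hn hne (Set.empty_subset _) h
  · obtain ⟨a, rfl⟩ := Set.ncard_eq_one.1 h1
    obtain ⟨e, he, hb, rfl⟩ := mem_toM.1 (h.1 rfl)
    obtain ⟨n, hn, hne, hb'⟩ := low2 m hm e (mem_bits.2 ⟨he, hb⟩)
    refine not_forcing hm hn hne ?_ h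
    rw [Set.singleton_subset_iff]
    exact (edge_mem_toM he).2 hb'

theorem L2_sub {m : ℕ} (hm : m ∈ L2) : m ∈ L := List.mem_append_left _ hm
theorem L3_sub {m : ℕ} (hm : m ∈ L3) : m ∈ L := List.mem_append_right _ hm

theorem lower_two {m : ℕ} (hm : m ∈ L3) {S : Set (Sym2 V)}
    (h : IsForcingSet (GP 11 2) (toM m) S) : 3 ≤ S.ncard := by
  by_contra hlt
  have h2 : S.ncard = 2 := by
    have := lower_one (L3_sub hm) h
    omega
  obtain ⟨a, b, -, rfl⟩ := Set.ncard_eq_two.1 h2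
  obtain ⟨e, he, hb, rfl⟩ := mem_toM.1 (h.1 (Set.mem_insert _ _))
  obtain ⟨f, hf, hb', rfl⟩ := mem_toM.1 (h.1 (Set.mem_insert_of_mem _ rfl))
  obtain ⟨n, hn, hne, h1, h2⟩ := low3 m hm e (mem_bits.2 ⟨he, hb⟩) f (mem_bits.2 ⟨hf, hb'⟩)
  refine not_forcing (L3_sub hm) hn hne ?_ h
  rw [Set.insert_subset_iff, Set.singleton_subset_iff]
  exact ⟨(edge_mem_toM he).2 h1, (edge_mem_toM hf).2 h2⟩

theorem fnum_eq {m k : ℕ} (hlow : ∀ S, IsForcingSet (GP 11 2) (toM m) S → k ≤ S.ncard)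
    (hex : ∃ S, IsForcingSet (GP 11 2) (toM m) S ∧ S.ncard = k) :
    forcingNum (GP 11 2) (toM m) = k := by
  unfold forcingNum
  apply le_antisymm
  · exact Nat.sInf_le hex
  · refine le_csInf ⟨k, hex⟩ ?_
    rintro j ⟨S, hS, rfl⟩
    exact hlow S hS

theorem fnum2 {m : ℕ} (hm : m ∈ L2) : forcingNum (GP 11 2) (toM m) = 2 := by
  refine fnum_eq (fun S => lower_one (L2_sub hm)) ?_
  obtain ⟨e, he, f, hf, hne, h⟩ := up2 m hm
  rw [mem_bits] at he hf
  refine ⟨{edgeOf e, edgeOf f}, forcing_of ?_ ?_, ?_⟩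
  · rw [Set.insert_subset_iff, Set.singleton_subset_iff, edge_mem_toM he.1, edge_mem_toM hf.1]
    exact ⟨he.2, hf.2⟩
  · intro n hn hs
    rw [Set.insert_subset_iff, Set.singleton_subset_iff, edge_mem_toM he.1,
      edge_mem_toM hf.1] at hs
    exact h n hn hs.1 hs.2
  · exact Set.ncard_pair fun hh => hne (edge_inj e he.1 f hf.1 hh)

theorem fnum3 {m : ℕ} (hm : m ∈ L3) : forcingNum (GP 11 2) (toM m) = 3 := by
  refine fnum_eq (fun S => lower_two hm) ?_
  obtain ⟨e, he, f, hf, hef, g, hg, heg, hfg, h⟩ := up3 m hm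
  rw [mem_bits] at he hf hg
  refine ⟨{edgeOf e, edgeOf f, edgeOf g}, forcing_of ?_ ?_, ?_⟩
  · rw [Set.insert_subset_iff, Set.insert_subset_iff, Set.singleton_subset_iff,
      edge_mem_toM he.1, edge_mem_toM hf.1, edge_mem_toM hg.1]
    exact ⟨he.2, hf.2, hg.2⟩
  · intro n hn hs
    rw [Set.insert_subset_iff, Set.insert_subset_iff, Set.singleton_subset_iff,
      edge_mem_toM he.1, edge_mem_toM hf.1, edge_mem_toM hg.1] at hs
    exact h n hn hs.1 hs.2.1 hs.2.2
  · exact Set.ncard_eq_three.2 ⟨_, _, _, fun hh => hef (edge_inj e he.1 f hf.1 hh),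
      fun hh => heg (edge_inj e he.1 g hg.1 hh), fun hh => hfg (edge_inj f hf.1 g hg.1 hh), rfl⟩

theorem count (l : List ℕ) (hl : ∀ m ∈ l, m ∈ L) (hd : l.Nodup) :
    (toM '' {m | m ∈ l}).ncard = l.length := by
  have hinj : Set.InjOn toM {m | m ∈ l} := fun a ha b hb h => toM_inj (hl a ha) (hl b hb) h
  rw [hinj.ncard_image]
  have : {m | m ∈ l} = (l.toFinset : Set ℕ) := by ext; simp
  rw [this, Set.ncard_coe_finset, List.toFinset_card_of_nodup hd]

theorem pm_cases {M : (GP 11 2).Subgraph} (hM : M.IsPerfectMatching) :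
    (∃ m ∈ L2, toM m = M) ∨ (∃ m ∈ L3, toM m = M) := by
  obtain ⟨m, hm, h⟩ := exists_mask hM
  rcases List.mem_append.1 hm with hm | hm
  · exact Or.inl ⟨m, hm, h⟩
  · exact Or.inr ⟨m, hm, h⟩

end PF

open PF

theorem stmt16 :
    {k | ∃ M : (GP 11 2).Subgraph, M.IsPerfectMatching ∧ forcingNum (GP 11 2) M = k} = {2, 3} ∧
    {M : (GP 11 2).Subgraph | M.IsPerfectMatching}.ncard = 45 ∧
    {M : (GP 11 2).Subgraph | M.IsPerfectMatching ∧ forcingNum (GP 11 2) M = 2}.ncard = 11 ∧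
    {M : (GP 11 2).Subgraph | M.IsPerfectMatching ∧ forcingNum (GP 11 2) M = 3}.ncard = 34 := by
  refine ⟨?_, ?_, ?_, ?_⟩
  · ext k
    simp only [Set.mem_setOf_eq, Set.mem_insert_iff, Set.mem_singleton_iff]
    constructor
    · rintro ⟨M, hM, rfl⟩
      rcases pm_cases hM with ⟨m, hm, rfl⟩ | ⟨m, hm, rfl⟩
      · exact Or.inl (fnum2 hm)
      · exact Or.inr (fnum3 hm)
    · rintro (rfl | rfl)
      · have h : 2504524953 ∈ L2 := by decide
        exact ⟨_, toM_pm (L2_sub h), fnum2 h⟩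
      · have h : 360185907 ∈ L3 := by decide
        exact ⟨_, toM_pm (L3_sub h), fnum3 h⟩
  · refine Eq.trans ?_ (count L (fun _ h => h) (by decide +kernel))
    refine congrArg Set.ncard ?_
    ext M
    constructor
    · intro hM
      exact exists_mask hM
    · rintro ⟨m, hm, rfl⟩
      exact toM_pm hm
  · refine Eq.trans ?_ (count L2 (fun _ h => L2_sub h) (by decide +kernel))
    refine congrArg Set.ncard ?_
    ext M
    constructor
    · rintro ⟨hM, h2⟩
      rcases pm_cases hM with ⟨m, hm, rfl⟩ | ⟨m, hm, rfl⟩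
      · exact ⟨m, hm, rfl⟩
      · have := fnum3 hm
        omega
    · rintro ⟨m, hm, rfl⟩
      exact ⟨toM_pm (L2_sub hm), fnum2 hm⟩
  · refine Eq.trans ?_ (count L3 (fun _ h => L3_sub h) (by decide +kernel))
    refine congrArg Set.ncard ?_
    ext M
    constructor
    · rintro ⟨hM, h2⟩
      rcases pm_cases hM with ⟨m, hm, rfl⟩ | ⟨m, hm, rfl⟩
      · have := fnum2 hm
        omega
      · exact ⟨m, hm, rfl⟩
    · rintro ⟨m, hm, rfl⟩
      exact ⟨toM_pm (L3_sub hm), fnum3 hm⟩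
end

section
/- The minimum forcing number of the generalized Petersen graph GP(12,2) is 2 and its maximum forcing number is 3; moreover GP(12,2) has exactly 54 perfect matchings, of which exactly 3 have forcing number 2. -/
open SimpleGraph

namespace GPForce

abbrev V := Fin 12 ⊕ Fin 12

/-- The edges of `GP 12 2`, indexed by `0..35`. -/
def edgeN (e : ℕ) : Sym2 V :=
  if e < 12 then s(Sum.inl (Fin.ofNat 12 e), Sum.inl (Fin.ofNat 12 (e + 2)))
  else if e < 24 then s(Sum.inl (Fin.ofNat 12 e), Sum.inr (Fin.ofNat 12 e))
  else s(Sum.inr (Fin.ofNat 12 e), Sum.inr (Fin.ofNat 12 (e + 1)))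

/-- Indices of the edges incident with a vertex. -/
def inc : V → List ℕ
  | Sum.inl i => [i.1, (i.1 + 10) % 12, 12 + i.1]
  | Sum.inr i => [12 + i.1, 24 + i.1, 24 + (i.1 + 11) % 12]

/-- Bitmask of the edges incident with a vertex. -/
def incMask (v : V) : ℕ := (inc v).foldr (fun e a => 2 ^ e ||| a) 0

def umask : List V → ℕ
  | [] => 0
  | v :: vs => umask vs ||| incMask v

/-- Restrictions of perfect matchings to the edges meeting a list of vertices. -/
def gen : List V → List ℕ
  | [] => [0]
  | v :: vs => (gen vs).flatMap fun T =>
      (((inc v).map (2 ^ ·)).filter fun c =>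
        Nat.beq (T &&& incMask v) (c &&& umask vs)).map (T ||| ·)

def verts : List V :=
  (List.range 12).flatMap fun i => [Sum.inl (Fin.ofNat 12 i), Sum.inr (Fin.ofNat 12 i)]

/-- Codes of all perfect matchings of `GP 12 2`. -/
def LL : List ℕ :=
  [16773120, 100597763, 184422406, 352071692, 687370264, 1357967408, 1441792051, 2699161696,
  2782986339, 2866810982, 5381550272, 5465374915, 5549199558, 5716848844, 9824257170,
  10746327424, 10830152067, 10913976710, 11081625996, 11416924568, 34401650689, 35072247833,
  35742844977, 37084039265, 39766427841, 45801802956, 45131204993, 45801802137, 39263478345,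
  42951763456, 43119412742, 43287062028, 43622360600, 44292957744, 45634152032, 45801801318,
  45801800499, 17200827392, 17536125964, 17871424536, 18542021680, 19883215968, 22565604544,
  22900903116, 19631741220, 22900902297, 22900901478, 21475881728, 21559706371, 21643531014,
  21811180300, 22146478872, 22817076016, 22900900659]

/-- Codes of the perfect matchings with forcing number two. -/
def AA : List ℕ := [9824257170, 39263478345, 19631741220]

lemma gen_eq : gen verts = LL := by decide +kernel
lemma umask_eq : umask verts = 2 ^ 36 - 1 := by decide +kernel
lemma LL_nodup : LL.Nodup := by decide +kernel
lemma AA_nodup : AA.Nodup := by decide +kernel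
lemma AA_sub : ∀ m ∈ AA, m ∈ LL := by decide +kernel
lemma LL_lt : ∀ m ∈ LL, m < 2 ^ 36 := by decide +kernel
lemma LL_perf : ∀ m ∈ LL, ∀ v : V, ∃ e ∈ inc v, m &&& incMask v = 2 ^ e := by decide +kernel

/-- Indices of the edges in a matching with a given code. -/
def bits (m : ℕ) : List ℕ := (List.range 36).filter m.testBit

def low1 (m : ℕ) : Bool := (bits m).all fun a =>
  LL.any fun x => !(Nat.beq x m) && x.testBit a
def low2 (m : ℕ) : Bool := (bits m).all fun a => (bits m).all fun b =>
  LL.any fun x => !(Nat.beq x m) && (x.testBit a && x.testBit b)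
def up2 (m : ℕ) : Bool := (bits m).any fun a => (bits m).any fun b =>
  LL.all fun x => Nat.beq x m || !(x.testBit a && x.testBit b)
def up3 (m : ℕ) : Bool := (bits m).any fun a => (bits m).any fun b => (bits m).any fun c =>
  LL.all fun x => Nat.beq x m || !(x.testBit a && (x.testBit b && x.testBit c))

lemma low1_all : (LL.all low1) = true := by decide +kernel
lemma low2_all : (LL.all fun m => AA.contains m || low2 m) = true := by decide +kernel
lemma up2_all : (AA.all up2) = true := by decide +kernel
lemma up3_all : (LL.all up3) = true := by decide +kernel

lemma mem_bits {m a : ℕ} : a ∈ bits m ↔ a < 36 ∧ m.testBit a = true := by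
  simp [bits]

lemma gp_adj : ∀ a b : V, (GP 12 2).Adj a b ↔ ∃ e : Fin 36, s(a, b) = edgeN e.1 := by
  have h1 : ∀ i j : Fin 12, (¬ i = j ∧ ((j : ℕ) = ((i : ℕ) + 2) % 12 ∨
      (i : ℕ) = ((j : ℕ) + 2) % 12)) ↔
      ∃ e : Fin 36, s((Sum.inl i : V), (Sum.inl j : V)) = edgeN e.1 := by decide +kernel
  have h2 : ∀ i j : Fin 12, i = j ↔
      ∃ e : Fin 36, s((Sum.inl i : V), (Sum.inr j : V)) = edgeN e.1 := by decide +kernel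
  have h3 : ∀ i j : Fin 12, (¬ i = j ∧ ((j : ℕ) = ((i : ℕ) + 1) % 12 ∨
      (i : ℕ) = ((j : ℕ) + 1) % 12)) ↔
      ∃ e : Fin 36, s((Sum.inr i : V), (Sum.inr j : V)) = edgeN e.1 := by decide +kernel
  rintro (i | i) (j | j)
  · rw [← h1]; simp [GP]
  · rw [← h2]; simp [GP]
  · rw [Sym2.eq_swap, ← h2]; simp [GP]
  · rw [← h3]; simp [GP]

lemma edgeN_inj : ∀ a b : Fin 36, edgeN a.1 = edgeN b.1 → a = b := by decide +kernel
lemma mem_edgeN : ∀ (v : V) (e : Fin 36), v ∈ edgeN e.1 ↔ (incMask v).testBit e.1 = true := by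
  decide +kernel
lemma mem_inc : ∀ (v : V) (e : Fin 36), v ∈ edgeN e.1 ↔ e.1 ∈ inc v := by
  decide +kernel
lemma inc_lt : ∀ v : V, ∀ e ∈ inc v, e < 36 := by decide +kernel
lemma incMask_lt : ∀ v : V, incMask v < 2 ^ 36 := by decide +kernel

abbrev GG := GP 12 2

open Classical in
/-- Code of a subgraph. -/
noncomputable def code (M : GG.Subgraph) : ℕ :=
  Nat.ofBits (fun e : Fin 36 => decide (edgeN e.1 ∈ M.edgeSet))

lemma code_lt (M : GG.Subgraph) : code M < 2 ^ 36 := Nat.ofBits_lt_two_pow _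

lemma code_bit (M : GG.Subgraph) (e : Fin 36) :
    (code M).testBit e.1 = true ↔ edgeN e.1 ∈ M.edgeSet := by
  unfold code
  rw [Nat.testBit_ofBits_lt _ _ e.2]
  simp

/-- Subgraph with a given code. -/
def dec (m : ℕ) : GG.Subgraph where
  verts := Set.univ
  Adj a b := ∃ e : Fin 36, m.testBit e.1 = true ∧ s(a, b) = edgeN e.1
  adj_sub := by
    rintro a b ⟨e, -, h⟩
    exact (gp_adj a b).2 ⟨e, h⟩
  edge_vert _ := trivial
  symm := ⟨by
    rintro a b ⟨e, h, h'⟩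
    exact ⟨e, h, by rw [Sym2.eq_swap]; exact h'⟩⟩

lemma dec_edge (m : ℕ) (z : Sym2 V) :
    z ∈ (dec m).edgeSet ↔ ∃ e : Fin 36, m.testBit e.1 = true ∧ z = edgeN e.1 := by
  induction z with
  | h a b => rw [Subgraph.mem_edgeSet]; rfl

lemma edge_of_mem (M : GG.Subgraph) {z : Sym2 V} (h : z ∈ M.edgeSet) :
    ∃ e : Fin 36, z = edgeN e.1 ∧ (code M).testBit e.1 = true := by
  induction z with
  | h a b =>
    obtain ⟨e, he⟩ := (gp_adj a b).1 (M.adj_sub h)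
    exact ⟨e, he, (code_bit M e).2 (he ▸ h)⟩

lemma code_dec {m : ℕ} (hm : m < 2 ^ 36) : code (dec m) = m := by
  apply Nat.eq_of_testBit_eq
  intro i
  by_cases hi : i < 36
  · rw [Bool.eq_iff_iff, code_bit (dec m) ⟨i, hi⟩, dec_edge]
    constructor
    · rintro ⟨e, h, h'⟩
      rw [← edgeN_inj _ _ h'] at h
      exact h
    · intro h
      exact ⟨⟨i, hi⟩, h, rfl⟩
  · have hp : 2 ^ 36 ≤ 2 ^ i := Nat.pow_le_pow_right (by norm_num) (by omega)
    rw [Nat.testBit_lt_two_pow ((code_lt _).trans_le hp), Nat.testBit_lt_two_pow (hm.trans_le hp)]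

lemma edgeSet_dec_code (M : GG.Subgraph) (z : Sym2 V) :
    z ∈ M.edgeSet ↔ ∃ e : Fin 36, (code M).testBit e.1 = true ∧ z = edgeN e.1 := by
  constructor
  · intro h
    obtain ⟨e, h1, h2⟩ := edge_of_mem M h
    exact ⟨e, h2, h1⟩
  · rintro ⟨e, h, rfl⟩
    exact (code_bit M e).1 h

lemma code_inj {M N : GG.Subgraph} (hM : M.IsPerfectMatching) (hN : N.IsPerfectMatching)
    (h : code M = code N) : M = N := by
  have hv : M.verts = N.verts := by
    ext v
    exact ⟨fun _ => hN.2 v, fun _ => hM.2 v⟩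
  apply Subgraph.ext hv
  ext a b
  rw [← Subgraph.mem_edgeSet, ← Subgraph.mem_edgeSet, edgeSet_dec_code, edgeSet_dec_code, h]

lemma dec_perf {m : ℕ} (hm : m ∈ LL) : (dec m).IsPerfectMatching := by
  rw [Subgraph.isPerfectMatching_iff]
  intro v
  obtain ⟨e, he, h⟩ := LL_perf m hm v
  have hlt := inc_lt v e he
  have hv : v ∈ edgeN e := (mem_inc v ⟨e, hlt⟩).2 he
  obtain ⟨w, hw⟩ := Sym2.mem_iff_exists.1 hv
  refine ⟨w, ⟨⟨e, hlt⟩, ?_, hw.symm⟩, ?_⟩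
  · have := congrArg (fun x => Nat.testBit x e) h
    simp only [Nat.testBit_and, Nat.testBit_two_pow_self, Bool.and_eq_true] at this
    exact this.1
  · rintro w' ⟨e', h1, h2⟩
    have hv' : v ∈ edgeN e'.1 := by rw [← h2]; simp
    have h3 := (mem_edgeN v e').1 hv'
    have := congrArg (fun x => Nat.testBit x e'.1) h
    simp only [Nat.testBit_and, h1, h3, Nat.testBit_two_pow, Bool.and_self] at this
    have h4 : e = e'.1 := by simpa using this.symm
    rw [← h4, hw] at h2
    exact Sym2.congr_right.1 h2

lemma code_perf {M : GG.Subgraph} (hM : M.IsPerfectMatching) (v : V) :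
    ∃ e ∈ inc v, code M &&& incMask v = 2 ^ e := by
  rw [Subgraph.isPerfectMatching_iff] at hM
  obtain ⟨w, hw, hu⟩ := hM v
  obtain ⟨e, he, hb⟩ := edge_of_mem M (Subgraph.mem_edgeSet.2 hw)
  have hv : v ∈ edgeN e.1 := by rw [← he]; simp
  refine ⟨e.1, (mem_inc v e).1 hv, ?_⟩
  apply Nat.eq_of_testBit_eq
  intro i
  rw [Nat.testBit_and, Nat.testBit_two_pow]
  by_cases hi : i < 36
  · rw [Bool.eq_iff_iff, Bool.and_eq_true, code_bit M ⟨i, hi⟩, ← mem_edgeN v ⟨i, hi⟩,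
      decide_eq_true_iff]
    constructor
    · rintro ⟨h1, h2⟩
      obtain ⟨w', hw'⟩ := Sym2.mem_iff_exists.1 h2
      rw [hw'] at h1
      have := hu w' (Subgraph.mem_edgeSet.1 h1)
      subst this
      rw [he] at hw'
      exact congrArg Fin.val (edgeN_inj _ _ hw').symm
    · rintro rfl
      exact ⟨(code_bit M e).1 hb, hv⟩
  · have hp : 2 ^ 36 ≤ 2 ^ i := Nat.pow_le_pow_right (by norm_num) (by omega)
    rw [Nat.testBit_lt_two_pow ((code_lt _).trans_le hp)]
    have : e.1 ≠ i := by have := e.2; omega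
    simp [this]

lemma gen_complete {m : ℕ} (hm : ∀ v, ∃ e ∈ inc v, m &&& incMask v = 2 ^ e) :
    ∀ l : List V, m &&& umask l ∈ gen l
  | [] => by simp [umask, gen]
  | v :: vs => by
    obtain ⟨e, he, h⟩ := hm v
    simp only [gen, List.mem_flatMap, List.mem_map, List.mem_filter]
    refine ⟨m &&& umask vs, gen_complete hm vs, 2 ^ e, ⟨⟨e, he, rfl⟩, ?_⟩, ?_⟩
    · rw [← h, Nat.beq_eq, Nat.and_assoc, Nat.and_assoc, Nat.and_comm (umask vs)]
    · rw [← h, umask, Nat.and_or_distrib_left]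

lemma code_mem {M : GG.Subgraph} (hM : M.IsPerfectMatching) : code M ∈ LL := by
  have := gen_complete (code_perf hM) verts
  rw [gen_eq, umask_eq, Nat.and_two_pow_sub_one_eq_mod, Nat.mod_eq_of_lt (code_lt M)] at this
  exact this

lemma ncard_eq (B : List ℕ) (hB : B.Nodup) (hs : ∀ m ∈ B, m ∈ LL) :
    {M : GG.Subgraph | M.IsPerfectMatching ∧ code M ∈ B}.ncard = B.length := by
  rw [← List.toFinset_card_of_nodup hB, ← Set.ncard_coe_finset]
  refine Set.ncard_congr (fun M _ => code M) ?_ ?_ ?_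
  · intro M hM
    simpa using hM.2
  · intro M N hM hN h
    exact code_inj hM.1 hN.1 h
  · intro m hm
    have hm' : m ∈ B := by simpa using hm
    have hc := code_dec (LL_lt m (hs m hm'))
    exact ⟨dec m, ⟨dec_perf (hs m hm'), by rw [hc]; exact hm'⟩, hc⟩

lemma forcing_eq {M : GG.Subgraph} {k : ℕ}
    (hlow : ∀ S, IsForcingSet GG M S → k ≤ S.ncard)
    (hup : ∃ S, IsForcingSet GG M S ∧ S.ncard ≤ k) : forcingNum GG M = k := by
  obtain ⟨S, hS, hk⟩ := hup
  apply le_antisymm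
  · have h : forcingNum GG M ≤ S.ncard := Nat.sInf_le ⟨S, hS, rfl⟩
    exact h.trans hk
  · refine le_csInf ⟨_, S, hS, rfl⟩ ?_
    rintro _ ⟨T, hT, rfl⟩
    exact hlow T hT

/-- A forcing list of edge indices gives a forcing set. -/
lemma forcing_of_list {M : GG.Subgraph} (l : List ℕ)
    (hl : ∀ e ∈ l, e ∈ bits (code M))
    (hf : ∀ x ∈ LL, x = code M ∨ ¬ ∀ e ∈ l, x.testBit e = true)
    (hM : M.IsPerfectMatching) :
    ∃ S, IsForcingSet GG M S ∧ S.ncard ≤ l.length := by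
  refine ⟨((l.map edgeN).toFinset : Set (Sym2 V)), ⟨?_, ?_⟩, ?_⟩
  · intro z hz
    obtain ⟨e, he, rfl⟩ : ∃ e ∈ l, edgeN e = z := by simpa using hz
    obtain ⟨h1, h2⟩ := mem_bits.1 (hl e he)
    exact (code_bit M ⟨e, h1⟩).1 h2
  · intro N hN hS
    rcases hf _ (code_mem hN) with h | h
    · exact code_inj hN hM h
    · refine absurd (fun e he => ?_) h
      obtain ⟨h1, h2⟩ := mem_bits.1 (hl e he)
      refine (code_bit N ⟨e, h1⟩).2 (hS ?_)
      have : ∃ a ∈ l, edgeN a = edgeN e := ⟨e, he, rfl⟩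
      simpa using this
  · rw [Set.ncard_coe_finset]
    exact (List.toFinset_card_le _).trans (by simp)

/-- Two edges contained in another perfect matching are not forcing. -/
lemma not_forcing {M : GG.Subgraph} {S : Set (Sym2 V)} (hS : IsForcingSet GG M S)
    {x : ℕ} (hx : x ∈ LL) (hne : x ≠ code M) (h : ∀ z ∈ S, z ∈ (dec x).edgeSet) : False := by
  have := hS.2 (dec x) (dec_perf hx) h
  rw [← this, code_dec (LL_lt x hx)] at hne
  exact hne rfl

lemma exists_edge {M : GG.Subgraph} (hM : M.IsPerfectMatching) : ∃ z, z ∈ M.edgeSet := by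
  obtain ⟨w, hw, -⟩ := Subgraph.isPerfectMatching_iff.1 hM (Sum.inl 0)
  exact ⟨_, Subgraph.mem_edgeSet.2 hw⟩

lemma lower1 {M : GG.Subgraph} (hM : M.IsPerfectMatching) (S) (hS : IsForcingSet GG M S) :
    2 ≤ S.ncard := by
  by_contra hlt
  obtain ⟨a, ha, hSa⟩ : ∃ a ∈ M.edgeSet, ∀ z ∈ S, z = a := by
    have hc : S.ncard = 0 ∨ S.ncard = 1 := by omega
    rcases hc with hc | hc
    · rw [Set.ncard_eq_zero (Set.toFinite S)] at hc
      obtain ⟨z, hz⟩ := exists_edge hM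
      exact ⟨z, hz, by simp [hc]⟩
    · obtain ⟨z, rfl⟩ := Set.ncard_eq_one.1 hc
      exact ⟨z, hS.1 rfl, by simp⟩
  obtain ⟨e, rfl, he⟩ := edge_of_mem M ha
  have h := List.all_eq_true.1 low1_all _ (code_mem hM)
  have h := List.all_eq_true.1 h e.1 (mem_bits.2 ⟨e.2, he⟩)
  obtain ⟨x, hx, h⟩ := List.any_eq_true.1 h
  simp only [Bool.and_eq_true, Bool.not_eq_true', ← Bool.not_eq_true, Nat.beq_eq] at h
  refine not_forcing hS hx h.1 fun z hz => ?_
  rw [hSa z hz, dec_edge]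
  exact ⟨e, h.2, rfl⟩

lemma lower2 {M : GG.Subgraph} (hM : M.IsPerfectMatching) (hA : code M ∉ AA)
    (S) (hS : IsForcingSet GG M S) : 3 ≤ S.ncard := by
  by_contra hlt
  obtain ⟨a, ha, b, hb, hSa⟩ : ∃ a ∈ M.edgeSet, ∃ b ∈ M.edgeSet, ∀ z ∈ S, z = a ∨ z = b := by
    have := lower1 hM S hS
    have hc : S.ncard = 2 := by omega
    obtain ⟨a, b, -, rfl⟩ := Set.ncard_eq_two.1 hc
    exact ⟨a, hS.1 (by simp), b, hS.1 (by simp), by simp⟩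
  obtain ⟨e, rfl, he⟩ := edge_of_mem M ha
  obtain ⟨f, rfl, hf⟩ := edge_of_mem M hb
  have h := List.all_eq_true.1 low2_all _ (code_mem hM)
  have h : low2 (code M) = true := by
    rcases Bool.or_eq_true _ _ ▸ h with h | h
    · exact absurd (List.contains_iff_mem.1 h) hA
    · exact h
  have h := List.all_eq_true.1 h e.1 (mem_bits.2 ⟨e.2, he⟩)
  have h := List.all_eq_true.1 h f.1 (mem_bits.2 ⟨f.2, hf⟩)
  obtain ⟨x, hx, h⟩ := List.any_eq_true.1 h
  simp only [Bool.and_eq_true, Bool.not_eq_true', ← Bool.not_eq_true, Nat.beq_eq] at h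
  refine not_forcing hS hx h.1 fun z hz => ?_
  rw [dec_edge]
  rcases hSa z hz with rfl | rfl
  · exact ⟨e, h.2.1, rfl⟩
  · exact ⟨f, h.2.2, rfl⟩

lemma forcing_two {M : GG.Subgraph} (hM : M.IsPerfectMatching) (hA : code M ∈ AA) :
    forcingNum GG M = 2 := by
  refine forcing_eq (lower1 hM) ?_
  have h := List.all_eq_true.1 up2_all _ hA
  obtain ⟨a, ha, h⟩ := List.any_eq_true.1 h
  obtain ⟨b, hb, h⟩ := List.any_eq_true.1 h
  refine forcing_of_list [a, b] (by simp [ha, hb]) (fun x hx => ?_) hM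
  have h := List.all_eq_true.1 h x hx
  simpa [Nat.beq_eq, -Bool.not_and, ← Bool.not_eq_true, ← imp_iff_not_or] using h

lemma forcing_three {M : GG.Subgraph} (hM : M.IsPerfectMatching) (hA : code M ∉ AA) :
    forcingNum GG M = 3 := by
  refine forcing_eq (lower2 hM hA) ?_
  have h := List.all_eq_true.1 up3_all _ (code_mem hM)
  obtain ⟨a, ha, h⟩ := List.any_eq_true.1 h
  obtain ⟨b, hb, h⟩ := List.any_eq_true.1 h
  obtain ⟨c, hc, h⟩ := List.any_eq_true.1 h
  refine forcing_of_list [a, b, c] (by simp [ha, hb, hc]) (fun x hx => ?_) hM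
  have h := List.all_eq_true.1 h x hx
  simpa [Nat.beq_eq, -Bool.not_and, ← Bool.not_eq_true, ← imp_iff_not_or] using h

lemma values_eq :
    {k | ∃ M : GG.Subgraph, M.IsPerfectMatching ∧ forcingNum GG M = k} = {2, 3} := by
  ext k
  constructor
  · rintro ⟨M, hM, rfl⟩
    by_cases hA : code M ∈ AA
    · exact Or.inl (forcing_two hM hA)
    · exact Or.inr (forcing_three hM hA)
  · have h1 : 9824257170 ∈ LL := by decide +kernel
    have h2 : 16773120 ∈ LL := by decide +kernel
    rintro (rfl | rfl)
    · refine ⟨dec 9824257170, dec_perf h1, forcing_two (dec_perf h1) ?_⟩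
      rw [code_dec (LL_lt _ h1)]
      decide +kernel
    · refine ⟨dec 16773120, dec_perf h2, forcing_three (dec_perf h2) ?_⟩
      rw [code_dec (LL_lt _ h2)]
      decide +kernel

end GPForce

theorem stmt17 :
    sInf {k | ∃ M : (GP 12 2).Subgraph, M.IsPerfectMatching ∧ forcingNum (GP 12 2) M = k} = 2 ∧
    sSup {k | ∃ M : (GP 12 2).Subgraph, M.IsPerfectMatching ∧ forcingNum (GP 12 2) M = k} = 3 ∧
    {M : (GP 12 2).Subgraph | M.IsPerfectMatching}.ncard = 54 ∧
    {M : (GP 12 2).Subgraph | M.IsPerfectMatching ∧ forcingNum (GP 12 2) M = 2}.ncard = 3 := by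
  rw [GPForce.values_eq]
  refine ⟨?_, ?_, ?_, ?_⟩
  · rw [csInf_pair]; rfl
  · rw [csSup_pair]; rfl
  · have h := GPForce.ncard_eq GPForce.LL GPForce.LL_nodup (fun _ h => h)
    rw [show GPForce.LL.length = 54 from rfl] at h
    rw [← h]
    congr 1
    ext M
    exact ⟨fun hM => ⟨hM, GPForce.code_mem hM⟩, fun hM => hM.1⟩
  · have h := GPForce.ncard_eq GPForce.AA GPForce.AA_nodup GPForce.AA_sub
    rw [show GPForce.AA.length = 3 from rfl] at h
    rw [← h]
    congr 1
    ext M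
    constructor
    · rintro ⟨hM, h2⟩
      refine ⟨hM, ?_⟩
      by_contra hA
      rw [GPForce.forcing_three hM hA] at h2
      omega
    · rintro ⟨hM, hA⟩
      exact ⟨hM, GPForce.forcing_two hM hA⟩
end
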